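/- Let (Ω, ℱ, μ) be a probability space and A, B : Ω → ℝ measurable with 0 < A(ω) ≤ B(ω) for μ-a.e. ω, μ({ω : A(ω) < B(ω)}) > 0, and ω ↦ A(ω)⁻¹ integrable; set g(γ) = ∫ A(ω)^(γ−1) · B(ω)^(−γ) dμ(ω). Let T_n < T_{n+1} be reals and let B₀ : [T_n, T_{n+1}] → ℝ be continuous and strictly decreasing with B₀(T_n) = g(0) and B₀(T_{n+1}) = g(1). Then there exists a unique function γ : [T_n, T_{n+1}] → [0,1] such that g(γ(T)) = B₀(T) for every T ∈ [T_n, T_{n+1}]; this γ satisfies γ(T_n) = 0 and γ(T_{n+1}) = 1. -/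

import Mathlib

open MeasureTheory Real

/-- Exponential interpolation of reciprocals, written as a power of the ratio. -/
lemma rpow_sub_one_mul_rpow_neg {a b : ℝ} (ha : 0 < a) (hb : 0 < b) (γ : ℝ) :
    a ^ (γ - 1) * b ^ (-γ) = a⁻¹ * (a / b) ^ γ := by
  rw [rpow_sub_one ha.ne', rpow_neg hb.le, div_rpow ha.le hb.le]
  ring

section Interpolation

variable {Ω : Type*} [MeasurableSpace Ω] {μ : Measure Ω} {A B : Ω → ℝ}

lemma ae_norm_rpow_mul_rpow_le_inv (hAB : ∀ᵐ ω ∂μ, 0 < A ω ∧ A ω ≤ B ω) {γ : ℝ} (hγ : 0 ≤ γ) :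
    ∀ᵐ ω ∂μ, ‖A ω ^ (γ - 1) * B ω ^ (-γ)‖ ≤ (A ω)⁻¹ := by
  filter_upwards [hAB] with ω ⟨ha, hab⟩
  have hb := ha.trans_le hab
  rw [rpow_sub_one_mul_rpow_neg ha hb, norm_of_nonneg (by positivity)]
  exact mul_le_of_le_one_right (by positivity)
    (rpow_le_one (by positivity) ((div_le_one hb).2 hab) hγ)

lemma aestronglyMeasurable_rpow_mul_rpow (hA : Measurable A) (hB : Measurable B) (γ : ℝ) :
    AEStronglyMeasurable (fun ω => A ω ^ (γ - 1) * B ω ^ (-γ)) μ :=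
  ((hA.pow_const _).mul (hB.pow_const _)).aestronglyMeasurable

lemma integrable_rpow_mul_rpow (hA : Measurable A) (hB : Measurable B)
    (hAB : ∀ᵐ ω ∂μ, 0 < A ω ∧ A ω ≤ B ω) (hint : Integrable (fun ω => (A ω)⁻¹) μ)
    {γ : ℝ} (hγ : 0 ≤ γ) : Integrable (fun ω => A ω ^ (γ - 1) * B ω ^ (-γ)) μ :=
  hint.mono' (aestronglyMeasurable_rpow_mul_rpow hA hB γ) (ae_norm_rpow_mul_rpow_le_inv hAB hγ)

lemma continuousOn_integral_rpow_mul_rpow (hA : Measurable A) (hB : Measurable B)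
    (hAB : ∀ᵐ ω ∂μ, 0 < A ω ∧ A ω ≤ B ω) (hint : Integrable (fun ω => (A ω)⁻¹) μ) :
    ContinuousOn (fun γ : ℝ => ∫ ω, A ω ^ (γ - 1) * B ω ^ (-γ) ∂μ) (Set.Ici 0) := by
  refine continuousOn_of_dominated (fun γ _ => aestronglyMeasurable_rpow_mul_rpow hA hB γ)
    (fun γ hγ => ae_norm_rpow_mul_rpow_le_inv hAB hγ) hint ?_
  filter_upwards [hAB] with ω ⟨ha, hab⟩
  have hb := ha.trans_le hab
  simp_rw [rpow_sub_one_mul_rpow_neg ha hb]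
  exact (continuous_const.mul (continuous_const_rpow (by positivity))).continuousOn

lemma strictAntiOn_integral_rpow_mul_rpow (hA : Measurable A) (hB : Measurable B)
    (hAB : ∀ᵐ ω ∂μ, 0 < A ω ∧ A ω ≤ B ω) (hpos : 0 < μ {ω | A ω < B ω})
    (hint : Integrable (fun ω => (A ω)⁻¹) μ) :
    StrictAntiOn (fun γ : ℝ => ∫ ω, A ω ^ (γ - 1) * B ω ^ (-γ) ∂μ) (Set.Ici 0) := by
  intro s hs t ht hst
  have his := integrable_rpow_mul_rpow hA hB hAB hint hs
  have hit := integrable_rpow_mul_rpow hA hB hAB hint ht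
  rw [← sub_pos, ← integral_sub his hit]
  refine (integral_pos_iff_support_of_nonneg_ae ?_ (his.sub hit)).2 ?_
  · filter_upwards [hAB] with ω ⟨ha, hab⟩
    have hb := ha.trans_le hab
    refine sub_nonneg.2 ?_
    simp only [rpow_sub_one_mul_rpow_neg ha hb]
    exact mul_le_mul_of_nonneg_left
      (rpow_le_rpow_of_exponent_ge (by positivity) ((div_le_one hb).2 hab) hst.le) (by positivity)
  · refine hpos.trans_le (measure_mono_ae ?_)
    filter_upwards [hAB] with ω ⟨ha, hab⟩ hlt
    have hb := ha.trans_le hab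
    refine (sub_pos.2 ?_).ne'
    simp only [rpow_sub_one_mul_rpow_neg ha hb]
    exact mul_lt_mul_of_pos_left
      (rpow_lt_rpow_of_exponent_gt (by positivity) ((div_lt_one hb).2 hlt) hst) (by positivity)

end Interpolation

/-- The central interpolation step: given the strictly decreasing continuous initial term
structure `B₀` on `[Tₙ, Tₙ₊₁]` with endpoint values `g 0` and `g 1`, there is a unique
function `γ : [Tₙ, Tₙ₊₁] → [0,1]` with `g (γ T) = B₀ T` for all `T`; it satisfies
`γ Tₙ = 0` and `γ Tₙ₊₁ = 1`. -/
theorem spotLibor_interpolation_function_existsUnique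
    {Ω : Type*} [MeasurableSpace Ω] (μ : Measure Ω) [IsProbabilityMeasure μ]
    (A B : Ω → ℝ) (hA : Measurable A) (hB : Measurable B)
    (hAB : ∀ᵐ ω ∂μ, 0 < A ω ∧ A ω ≤ B ω)
    (hpos : 0 < μ {ω | A ω < B ω})
    (hint : Integrable (fun ω => (A ω)⁻¹) μ)
    (g : ℝ → ℝ) (hg : ∀ γ : ℝ, g γ = ∫ ω, A ω ^ (γ - 1) * B ω ^ (-γ) ∂μ)
    (Tn Tn1 : ℝ) (hT : Tn < Tn1) (B₀ : ℝ → ℝ)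
    (hB₀cont : ContinuousOn B₀ (Set.Icc Tn Tn1))
    (hB₀anti : StrictAntiOn B₀ (Set.Icc Tn Tn1))
    (hB₀n : B₀ Tn = g 0) (hB₀n1 : B₀ Tn1 = g 1) :
    ∃ γf : ℝ → ℝ,
      (∀ T ∈ Set.Icc Tn Tn1, γf T ∈ Set.Icc (0 : ℝ) 1 ∧ g (γf T) = B₀ T) ∧
      (∀ γf' : ℝ → ℝ,
        (∀ T ∈ Set.Icc Tn Tn1, γf' T ∈ Set.Icc (0 : ℝ) 1 ∧ g (γf' T) = B₀ T) →
        ∀ T ∈ Set.Icc Tn Tn1, γf' T = γf T) ∧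
      γf Tn = 0 ∧ γf Tn1 = 1 := by
  obtain rfl : g = fun γ : ℝ => ∫ ω, A ω ^ (γ - 1) * B ω ^ (-γ) ∂μ := funext hg
  set g : ℝ → ℝ := fun γ => ∫ ω, A ω ^ (γ - 1) * B ω ^ (-γ) ∂μ
  have hcont : ContinuousOn g (Set.Icc 0 1) :=
    (continuousOn_integral_rpow_mul_rpow hA hB hAB hint).mono Set.Icc_subset_Ici_self
  have hinj : Set.InjOn g (Set.Icc 0 1) :=
    ((strictAntiOn_integral_rpow_mul_rpow hA hB hAB hpos hint).mono
      Set.Icc_subset_Ici_self).injOn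
  have hn : Tn ∈ Set.Icc Tn Tn1 := Set.left_mem_Icc.2 hT.le
  have hn1 : Tn1 ∈ Set.Icc Tn Tn1 := Set.right_mem_Icc.2 hT.le
  have hex : ∀ T, ∃ γ, T ∈ Set.Icc Tn Tn1 → γ ∈ Set.Icc (0 : ℝ) 1 ∧ g γ = B₀ T := by
    intro T
    by_cases h : T ∈ Set.Icc Tn Tn1
    · obtain ⟨γ, hγ⟩ := intermediate_value_Icc' zero_le_one hcont
        ⟨hB₀n1 ▸ hB₀anti.antitoneOn h hn1 h.2, hB₀n ▸ hB₀anti.antitoneOn hn h h.1⟩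
      exact ⟨γ, fun _ => hγ⟩
    · exact ⟨0, fun h' => absurd h' h⟩
  choose γf hγf using hex
  refine ⟨γf, hγf, fun γf' h' T hT' => ?_, ?_, ?_⟩
  · exact hinj (h' T hT').1 (hγf T hT').1 ((h' T hT').2.trans (hγf T hT').2.symm)
  · exact hinj (hγf Tn hn).1 (Set.left_mem_Icc.2 zero_le_one) ((hγf Tn hn).2.trans hB₀n)
  · exact hinj (hγf Tn1 hn1).1 (Set.right_mem_Icc.2 zero_le_one) ((hγf Tn1 hn1).2.trans hB₀n1)
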